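/- Let G = (V,E) be a perfect graph and let Ḡ denote its complement graph. Then xc(STAB(Ḡ)) ≤ xc(STAB(G)) + |V|. -/

import Mathlib

/-- A polytope is the convex hull of a finite set of points. -/
def IsPolytope {E : Type*} [AddCommGroup E] [Module ℝ E] (P : Set E) : Prop :=
  ∃ F : Set E, F.Finite ∧ P = convexHull ℝ F

/-- An (exposed) face of a set `Q ⊆ ℝ^κ`. -/
def IsExposedFace {κ : Type*} [Fintype κ] (Q F : Set (κ → ℝ)) : Prop :=
  F ⊆ Q ∧ ∃ (c : κ → ℝ) (α : ℝ), (∀ y ∈ Q, ∑ i, c i * y i ≤ α) ∧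
    F = {y ∈ Q | ∑ i, c i * y i = α}

/-- A facet of `Q`: a maximal proper nonempty face of `Q`. -/
def IsFacet {κ : Type*} [Fintype κ] (Q F : Set (κ → ℝ)) : Prop :=
  IsExposedFace Q F ∧ F.Nonempty ∧ F ≠ Q ∧
    ∀ F' : Set (κ → ℝ), IsExposedFace Q F' → F'.Nonempty → F' ≠ Q → F ⊆ F' → F' = F

/-- The size of a polytope: its number of facets. -/
noncomputable def polySize {κ : Type*} [Fintype κ] (Q : Set (κ → ℝ)) : ℕ :=
  {F : Set (κ → ℝ) | IsFacet Q F}.ncard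

/-- `Q` is an extension of `P` if `Q` is a polytope and some linear map sends `Q` onto `P`. -/
def IsExtension {ι κ : Type*} [Fintype ι] [Fintype κ]
    (P : Set (ι → ℝ)) (Q : Set (κ → ℝ)) : Prop :=
  IsPolytope Q ∧ ∃ π : (κ → ℝ) →ₗ[ℝ] (ι → ℝ), π '' Q = P

/-- The extension complexity of `P`: the minimum number of facets of an extension of `P`. -/
noncomputable def xc {ι : Type*} [Fintype ι] (P : Set (ι → ℝ)) : ℕ :=
  sInf {r : ℕ | ∃ (k : ℕ) (Q : Set (Fin k → ℝ)), IsExtension P Q ∧ polySize Q = r}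

/-- The stable set polytope of a graph: the convex hull of the characteristic vectors of
its independent (stable) sets. -/
def stab {V : Type*} [Fintype V] (G : SimpleGraph V) : Set (V → ℝ) :=
  convexHull ℝ {x : V → ℝ |
    ∃ S : Set V, (∀ u ∈ S, ∀ v ∈ S, ¬ G.Adj u v) ∧ x = S.indicator 1}

/-- The clique number of a graph. -/
noncomputable def cliqueNum {V : Type*} (G : SimpleGraph V) : ℕ :=
  sSup {n : ℕ | ∃ s : Finset V, G.IsNClique n s}

/-- A graph is perfect if every induced subgraph has chromatic number equal to its
clique number. -/
def IsPerfect {V : Type*} (G : SimpleGraph V) : Prop :=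
  ∀ S : Set V, (G.induce S).chromaticNumber = (cliqueNum (G.induce S) : ℕ∞)


lemma isExposedFace_iff {κ : Type*} [Fintype κ] (Q F : Set (κ → ℝ)) :
    IsExposedFace Q F ↔ ∃ (c : κ → ℝ) (α : ℝ), (∀ y ∈ Q, 0 ≤ α - ∑ i, c i * y i) ∧
      F = {y ∈ Q | α - ∑ i, c i * y i = 0} := by
  constructor
  · rintro ⟨_, c, α, h1, h2⟩
    refine ⟨c, α, fun y hy => sub_nonneg.2 (h1 y hy), ?_⟩
    rw [h2]
    ext y
    simp only [Set.mem_ofPred_eq, sub_eq_zero]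
    rw [eq_comm (a := α)]
  · rintro ⟨c, α, h1, h2⟩
    refine ⟨by rw [h2]; exact fun y hy => hy.1, c, α, fun y hy => sub_nonneg.1 (h1 y hy), ?_⟩
    rw [h2]
    ext y
    simp only [Set.mem_ofPred_eq, sub_eq_zero]
    rw [eq_comm (a := α)]

/-- the affine function with coefficients `c`, `α` -/
def slk {κ : Type*} [Fintype κ] (p : (κ → ℝ) × ℝ) (y : κ → ℝ) : ℝ := p.2 - ∑ i, p.1 i * y i

lemma slk_sub {κ : Type*} [Fintype κ] (p q : (κ → ℝ) × ℝ) (t : ℝ) (y : κ → ℝ) :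
    slk (p - t • q) y = slk p y - t * slk q y := by
  simp only [slk, Prod.snd_sub, Prod.fst_sub, Prod.smul_fst, Prod.smul_snd, Pi.sub_apply,
    Pi.smul_apply, smul_eq_mul, sub_mul, Finset.sum_sub_distrib, mul_sub, Finset.mul_sum, mul_assoc]
  ring

lemma slk_comb {κ : Type*} [Fintype κ] (p : (κ → ℝ) × ℝ) (y z : κ → ℝ) (a b : ℝ) (h : a + b = 1) :
    slk p (a • y + b • z) = a * slk p y + b * slk p z := by
  have : ∑ i, p.1 i * (a • y + b • z) i = a * ∑ i, p.1 i * y i + b * ∑ i, p.1 i * z i := by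
    rw [Finset.mul_sum, Finset.mul_sum, ← Finset.sum_add_distrib]
    refine Finset.sum_congr rfl fun i _ => ?_
    simp
    ring
  simp only [slk, this]
  have : p.2 = (a + b) * p.2 := by rw [h, one_mul]
  linear_combination this

lemma slk_nonneg {κ : Type*} [Fintype κ] (p : (κ → ℝ) × ℝ) (T : Set (κ → ℝ))
    (h : ∀ y ∈ T, 0 ≤ slk p y) : ∀ y ∈ convexHull ℝ T, 0 ≤ slk p y := by
  have : convexHull ℝ T ⊆ {y | 0 ≤ slk p y} := by
    refine convexHull_min h ?_
    intro y hy z hz a b ha hb hab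
    simp only [Set.mem_ofPred_eq] at *
    rw [slk_comb p y z a b hab]
    positivity
  exact this

lemma slk_zero {κ : Type*} [Fintype κ] (p : (κ → ℝ) × ℝ) (T : Set (κ → ℝ))
    (h : ∀ y ∈ T, slk p y = 0) : ∀ y ∈ convexHull ℝ T, slk p y = 0 := by
  have : convexHull ℝ T ⊆ {y | slk p y = 0} := by
    refine convexHull_min h ?_
    intro y hy z hz a b ha hb hab
    simp only [Set.mem_ofPred_eq] at *
    rw [slk_comb p y z a b hab, hy, hz]
    simp
  exact this

/-- face inclusion is determined on the generators -/
lemma slk_mono {κ : Type*} [Fintype κ] (p q : (κ → ℝ) × ℝ) (T : Set (κ → ℝ)) (hT : T.Finite)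
    (hp : ∀ y ∈ T, 0 ≤ slk p y)
    (h : ∀ y ∈ T, slk p y = 0 → slk q y = 0) :
    ∀ y ∈ convexHull ℝ T, 0 ≤ slk q y → slk p y = 0 → slk q y = 0 := by
  have hM : ∃ M : ℝ, ∀ y ∈ T, slk q y ≤ M * slk p y := by
    obtain ⟨M, hM⟩ := (hT.image (fun y => slk q y / slk p y)).bddAbove
    refine ⟨M, fun y hy => ?_⟩
    by_cases h0 : slk p y = 0
    · simp [h0, h y hy h0]
    · have hpos := lt_of_le_of_ne (hp y hy) (Ne.symm h0)
      have := hM (Set.mem_image_of_mem _ hy)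
      exact (div_le_iff₀ hpos).1 this
  obtain ⟨M, hM⟩ := hM
  intro y hy hq h0
  -- M p - q is nonneg on T
  have h1 := slk_nonneg (M • p - (1:ℝ) • q) T (fun z hz => by
    have h2 := hM z hz
    have h3 : slk (M • p) z = M * slk p z := by
      have := slk_sub 0 p (-M) z
      simpa [slk] using this
    rw [slk_sub, h3]; linarith) y hy
  have h3 : slk (M • p) y = M * slk p y := by
    have := slk_sub 0 p (-M) y
    simpa [slk] using this
  rw [slk_sub, h3, h0] at h1
  linarith

lemma exposed_slk {κ : Type*} [Fintype κ] (Q F : Set (κ → ℝ)) :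
    IsExposedFace Q F ↔ ∃ p, (∀ y ∈ Q, 0 ≤ slk p y) ∧ F = {y ∈ Q | slk p y = 0} := by
  rw [isExposedFace_iff]
  constructor
  · rintro ⟨c, α, h⟩
    exact ⟨(c, α), h⟩
  · rintro ⟨p, h⟩
    exact ⟨p.1, p.2, h⟩

lemma facets_finite {κ : Type*} [Fintype κ] (T : Set (κ → ℝ)) (hT : T.Finite) :
    {F | IsExposedFace (convexHull ℝ T) F}.Finite := by
  refine Set.Finite.of_injOn (f := fun F => F ∩ T) (t := 𝒫 T)
    (fun _ _ => Set.inter_subset_right) ?_ hT.powerset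
  have key : ∀ F F', IsExposedFace (convexHull ℝ T) F → IsExposedFace (convexHull ℝ T) F' →
      F ∩ T ⊆ F' ∩ T → F ⊆ F' := by
    intro F F' hF hF' hsub
    obtain ⟨p, hp, rfl⟩ := (exposed_slk _ _).1 hF
    obtain ⟨q, hq, rfl⟩ := (exposed_slk _ _).1 hF'
    rintro y ⟨hy, h0⟩
    refine ⟨hy, slk_mono p q T hT (fun z hz => hp z (subset_convexHull ℝ T hz)) ?_ y hy (hq y hy) h0⟩
    intro z hz hz0
    exact (hsub ⟨⟨subset_convexHull ℝ T hz, hz0⟩, hz⟩).1.2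
  intro F hF F' hF' heq
  exact Set.Subset.antisymm (key F F' hF hF' heq.le) (key F' F hF' hF heq.ge)

/-- every proper nonempty face is in a facet -/
lemma exists_facet {κ : Type*} [Fintype κ] (T : Set (κ → ℝ)) (hT : T.Finite) (F : Set (κ → ℝ))
    (hF : IsExposedFace (convexHull ℝ T) F) (hne : F.Nonempty) (hneq : F ≠ convexHull ℝ T) :
    ∃ F', IsFacet (convexHull ℝ T) F' ∧ F ⊆ F' := by
  have hfin : {F' | IsExposedFace (convexHull ℝ T) F' ∧ F'.Nonempty ∧ F' ≠ convexHull ℝ T}.Finite :=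
    (facets_finite T hT).subset fun _ h => h.1
  obtain ⟨F', hle, hmax⟩ := hfin.exists_le_maximal (a := F) ⟨hF, hne, hneq⟩
  refine ⟨F', ⟨hmax.prop.1, hmax.prop.2.1, hmax.prop.2.2, ?_⟩, hle⟩
  intro F'' h1 h2 h3 h4
  exact (hmax.eq_of_le ⟨h1, h2, h3⟩ h4).symm

lemma decompose {κ : Type*} [Fintype κ] (T : Set (κ → ℝ)) (hT : T.Finite)
    (hnt : (convexHull ℝ T).Nontrivial)
    {I : Type*} [Fintype I] (S : I → (κ → ℝ) × ℝ)
    (hS : ∀ i, ∀ y ∈ convexHull ℝ T, 0 ≤ slk (S i) y)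
    (hfac : ∀ F, IsFacet (convexHull ℝ T) F → ∃ i, F = {y ∈ convexHull ℝ T | slk (S i) y = 0}) :
    ∀ p, (∀ y ∈ convexHull ℝ T, 0 ≤ slk p y) →
      ∃ l : I → ℝ, 0 ≤ l ∧ ∀ y ∈ convexHull ℝ T, slk p y = ∑ i, l i * slk (S i) y := by
  classical
  have hTsub := subset_convexHull ℝ T
  -- main step: a facet slack supported in supp p
  have step : ∀ p, (∀ y ∈ convexHull ℝ T, 0 ≤ slk p y) → (∃ y ∈ T, slk p y ≠ 0) →
      ∃ i, (∃ y ∈ T, slk (S i) y ≠ 0) ∧ ∀ y ∈ T, slk p y = 0 → slk (S i) y = 0 := by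
    intro p hp hne
    have fromface : ∀ q, (∀ y ∈ convexHull ℝ T, 0 ≤ slk q y) → (∃ y ∈ T, slk q y ≠ 0) →
        (∃ y ∈ T, slk q y = 0) →
        ∃ i, (∃ y ∈ T, slk (S i) y ≠ 0) ∧ ∀ y ∈ T, slk q y = 0 → slk (S i) y = 0 := by
      rintro q hq ⟨y1, hy1, hy1'⟩ ⟨y0, hy0, hy0'⟩
      obtain ⟨F', hF', hsub⟩ := exists_facet T hT {y ∈ convexHull ℝ T | slk q y = 0}
        ((exposed_slk _ _).2 ⟨q, hq, rfl⟩) ⟨y0, hTsub hy0, hy0'⟩ (fun h => by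
          have := hTsub hy1
          rw [← h] at this
          exact hy1' this.2)
      obtain ⟨i, hi⟩ := hfac F' hF'
      refine ⟨i, ?_, ?_⟩
      · by_contra hcon
        push Not at hcon
        apply hF'.2.2.1
        rw [hi]
        ext y
        exact ⟨fun h => h.1, fun h => ⟨h, slk_zero _ T hcon y h⟩⟩
      · intro y hy h0
        have := hsub ⟨hTsub hy, h0⟩
        rw [hi] at this
        exact this.2
    by_cases hz : ∃ y ∈ T, slk p y = 0
    · exact fromface p hp hne hz
    · push Not at hz
      -- a nonconstant functional
      have hTnt : T.Nontrivial := by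
        by_contra hcon
        rw [Set.not_nontrivial_iff] at hcon
        rcases hcon.eq_empty_or_singleton with h | ⟨a, h⟩
        · rw [h, convexHull_empty] at hnt
          exact Set.not_nontrivial_empty hnt
        · rw [h, convexHull_singleton] at hnt
          exact Set.not_nontrivial_singleton hnt
      obtain ⟨a, ha, b, hb, hab⟩ := hTnt
      obtain ⟨j, hj⟩ := Function.ne_iff.1 hab
      obtain ⟨m, hm, hmax⟩ := Set.exists_max_image T (fun y => y j) hT ⟨a, ha⟩
      have hq : ∀ y, slk (Pi.single j 1, m j) y = m j - y j := by
        intro y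
        simp [slk, Pi.single_apply]
      obtain ⟨i, h1, h2⟩ := fromface (Pi.single j 1, m j)
        (slk_nonneg _ T fun y hy => by rw [hq]; exact sub_nonneg.2 (hmax y hy))
        (by
          by_contra hcon
          push Not at hcon
          have e1 := hcon a ha
          have e2 := hcon b hb
          rw [hq] at e1 e2
          apply hj; linarith)
        ⟨m, hm, by rw [hq]; simp⟩
      exact ⟨i, h1, fun y hy h0 => absurd h0 (hz y hy)⟩
  -- induction on support size
  have main : ∀ n : ℕ, ∀ p, (∀ y ∈ convexHull ℝ T, 0 ≤ slk p y) →
      {y ∈ T | slk p y ≠ 0}.ncard ≤ n →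
      ∃ l : I → ℝ, 0 ≤ l ∧ ∀ y ∈ convexHull ℝ T, slk p y = ∑ i, l i * slk (S i) y := by
    intro n
    induction n with
    | zero =>
      intro p hp hcard
      have hfin : {y ∈ T | slk p y ≠ 0}.Finite := hT.subset fun _ h => h.1
      have hemp : {y ∈ T | slk p y ≠ 0} = ∅ := (Set.ncard_eq_zero hfin).1 (Nat.le_zero.1 hcard)
      refine ⟨0, le_rfl, fun y hy => ?_⟩
      simp only [Pi.zero_apply, zero_mul, Finset.sum_const_zero]
      refine slk_zero p T (fun z hz => ?_) y hy
      by_contra h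
      have : z ∈ {y ∈ T | slk p y ≠ 0} := ⟨hz, h⟩
      rw [hemp] at this
      exact this
    | succ n ih =>
      intro p hp hcard
      by_cases hne : ∃ y ∈ T, slk p y ≠ 0
      · obtain ⟨i, ⟨y1, hy1, hy1'⟩, hsupp⟩ := step p hp hne
        have hfin : {y ∈ T | slk (S i) y ≠ 0}.Finite := hT.subset fun _ h => h.1
        obtain ⟨m, ⟨hm, hm'⟩, hmin⟩ := Set.exists_min_image _ (fun y => slk p y / slk (S i) y) hfin
          ⟨y1, hy1, hy1'⟩
        have hmpos : 0 < slk (S i) m := lt_of_le_of_ne (hS i m (hTsub hm)) (Ne.symm hm')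
        set t := slk p m / slk (S i) m with ht
        have ht0 : 0 ≤ t := div_nonneg (hp m (hTsub hm)) hmpos.le
        have hnn : ∀ y ∈ T, 0 ≤ slk (p - t • S i) y := by
          intro y hy
          rw [slk_sub]
          by_cases h0 : slk (S i) y = 0
          · rw [h0]; simpa using hp y (hTsub hy)
          · have hpos : 0 < slk (S i) y := lt_of_le_of_ne (hS i y (hTsub hy)) (Ne.symm h0)
            have := hmin y ⟨hy, h0⟩
            have := (le_div_iff₀ hpos).1 this
            linarith
        obtain ⟨l, hl, hly⟩ := ih (p - t • S i) (slk_nonneg _ T hnn) (by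
          have hlt : {y ∈ T | slk (p - t • S i) y ≠ 0} ⊂ {y ∈ T | slk p y ≠ 0} := by
            refine (Set.ssubset_iff_of_subset ?_).2 ⟨m, ⟨hm, fun h => hm' (hsupp m hm h)⟩, ?_⟩
            · rintro y ⟨hy, h⟩
              refine ⟨hy, fun h0 => h ?_⟩
              rw [slk_sub, h0, hsupp y hy h0]; simp
            · rintro ⟨_, h⟩
              apply h
              rw [slk_sub, ht]
              field_simp
              simp
          have := Set.ncard_lt_ncard hlt (hT.subset fun _ h => h.1)
          omega)
        refine ⟨l + Pi.single i t, add_nonneg hl (Pi.single_nonneg.2 ht0), fun y hy => ?_⟩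
        have := hly y hy
        rw [slk_sub] at this
        simp only [Pi.add_apply, add_mul, Finset.sum_add_distrib, ← this]
        simp [Pi.single_apply]
      · refine ih p hp ?_
        push Not at hne
        have : {y ∈ T | slk p y ≠ 0} = ∅ := by
          ext y; simp; exact hne y
        rw [this]; simp
  exact fun p hp => main _ p hp le_rfl
open Filter Topology

lemma exists_step {ι : Type*} [Fintype ι] (z z' : ι → ℝ) (hz : 0 ≤ z)
    (h : ∀ i, z i = 0 → z' i = 0) : ∃ ε : ℝ, 0 < ε ∧ 0 ≤ z + ε • (z - z') := by
  have key : ∀ i, ∀ᶠ ε : ℝ in 𝓝[>] 0, 0 ≤ z i + ε * (z i - z' i) := by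
    intro i
    by_cases h0 : z i = 0
    · simp [h0, h i h0]
    · have hpos : 0 < z i := lt_of_le_of_ne (hz i) (Ne.symm h0)
      have hc : Tendsto (fun ε : ℝ => z i + ε * (z i - z' i)) (𝓝 0) (𝓝 (z i)) := by
        have : Continuous (fun ε : ℝ => z i + ε * (z i - z' i)) := by fun_prop
        simpa using this.tendsto 0
      have := (hc.eventually (lt_mem_nhds hpos)).filter_mono (nhdsWithin_le_nhds (s := Set.Ioi 0))
      exact this.mono fun _ h => h.le
  have := (eventually_all.2 key).and (self_mem_nhdsWithin (a := (0:ℝ)) (s := Set.Ioi 0))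
  obtain ⟨ε, h1, h2⟩ := this.exists
  exact ⟨ε, h2, fun i => by simpa using h1 i⟩

lemma polytope_of_orthant {ι : Type*} [Fintype ι] (A R : Set (ι → ℝ))
    (hA : ∀ z ∈ A, ∀ z' ∈ A, ∀ t : ℝ, z + t • (z - z') ∈ A) (hAc : IsClosed A)
    (hR : R = {z | z ∈ A ∧ 0 ≤ z}) (hb : Bornology.IsBounded R) :
    IsPolytope R ∧ polySize R ≤ Fintype.card ι := by
  classical
  have hstep : ∀ z ∈ R, ∀ z' ∈ R, (∀ i, z i = 0 → z' i = 0) →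
      ∃ ε : ℝ, 0 < ε ∧ z + ε • (z - z') ∈ R := by
    intro z hz z' hz' h
    rw [hR] at hz hz'
    obtain ⟨ε, h1, h2⟩ := exists_step z z' hz.2 h
    refine ⟨ε, h1, ?_⟩
    rw [hR]
    exact ⟨hA z hz.1 z' hz'.1 ε, h2⟩
  have hconv : Convex ℝ R := by
    intro z hz z' hz' a b ha hb hab
    rw [hR] at hz hz' ⊢
    refine ⟨?_, ?_⟩
    · have := hA z hz.1 z' hz'.1 (-b)
      convert this using 1
      ext i
      simp
      have : a = 1 - b := by linarith
      subst this; ring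
    · intro i
      have h1 := hz.2 i
      have h2 := hz'.2 i
      simp at h1 h2 ⊢
      positivity
  have hclosed : IsClosed R := by
    rw [hR]
    exact hAc.inter (isClosed_Ici (a := (0 : ι → ℝ)))
  have hcomp : IsCompact R := Metric.isCompact_of_isClosed_isBounded hclosed hb
  refine ⟨⟨R.extremePoints ℝ, ?_, ?_⟩, ?_⟩
  · refine Set.Finite.of_injOn (f := fun z : ι → ℝ => {i | z i = 0}) (t := Set.univ)
      (fun _ _ => Set.mem_univ _) ?_ Set.finite_univ
    intro z hz z' hz' heq
    by_contra hne
    have heq' : ∀ i, z i = 0 ↔ z' i = 0 := fun i => by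
      have := congrArg (fun s => i ∈ s) heq
      simpa using this
    obtain ⟨ε, hε, hm⟩ := hstep z hz.1 z' hz'.1 (fun i => (heq' i).1)
    have hseg : z ∈ openSegment ℝ (z + ε • (z - z')) z' := by
      refine ⟨1 / (1 + ε), ε / (1 + ε), by positivity, by positivity, by field_simp, ?_⟩
      ext i
      simp
      field_simp
      ring
    have := hz.2 hm hz'.1 hseg
    apply hne
    have h3 : ε • (z - z') = 0 := by simpa using this
    rcases smul_eq_zero.1 h3 with h | h
    · exact absurd h hε.ne'
    · exact sub_eq_zero.1 h
  · have hfin : (R.extremePoints ℝ).Finite := by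
      refine Set.Finite.of_injOn (f := fun z : ι → ℝ => {i | z i = 0}) (t := Set.univ)
        (fun _ _ => Set.mem_univ _) ?_ Set.finite_univ
      intro z hz z' hz' heq
      by_contra hne
      have heq' : ∀ i, z i = 0 ↔ z' i = 0 := fun i => by
        have := congrArg (fun s => i ∈ s) heq
        simpa using this
      obtain ⟨ε, hε, hm⟩ := hstep z hz.1 z' hz'.1 (fun i => (heq' i).1)
      have hseg : z ∈ openSegment ℝ (z + ε • (z - z')) z' := by
        refine ⟨1 / (1 + ε), ε / (1 + ε), by positivity, by positivity, by field_simp, ?_⟩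
        ext i
        simp
        field_simp
        ring
      have := hz.2 hm hz'.1 hseg
      apply hne
      have h3 : ε • (z - z') = 0 := by simpa using this
      rcases smul_eq_zero.1 h3 with h | h
      · exact absurd h hε.ne'
      · exact sub_eq_zero.1 h
    rw [← (hfin.isCompact_convexHull (𝕜 := ℝ)).isClosed.closure_eq]
    exact (closure_convexHull_extremePoints hcomp hconv).symm
  · have hsub : {F : Set (ι → ℝ) | IsFacet R F} ⊆
        Set.range (fun i : ι => {z ∈ R | z i = 0}) := by
      rintro F ⟨⟨hFR, c, α, hle, hF⟩, hne, hneq, hmax⟩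
      have hexp : ∀ i : ι, IsExposedFace R {z ∈ R | z i = 0} := by
        intro i
        refine ⟨fun z hz => hz.1, fun j => if j = i then -1 else 0, 0, ?_, ?_⟩
        · intro y hy
          rw [hR] at hy
          have := hy.2 i
          simpa using this
        · simp
      suffices h : ∃ i : ι, {z ∈ R | z i = 0} ≠ R ∧ F ⊆ {z ∈ R | z i = 0} by
        obtain ⟨i, h1, h2⟩ := h
        exact ⟨i, hmax _ (hexp i) (hne.mono h2) h1 h2⟩
      by_contra hcon
      push Not at hcon
      have hFconv : Convex ℝ F := by
        rw [hF]
        intro z hz z' hz' a b ha hb hab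
        refine ⟨hconv hz.1 hz'.1 ha hb hab, ?_⟩
        have h1 := hz.2
        have h2 := hz'.2
        calc ∑ i, c i * (a • z + b • z') i
            = a * ∑ i, c i * z i + b * ∑ i, c i * z' i := by
              rw [Finset.mul_sum, Finset.mul_sum, ← Finset.sum_add_distrib]
              refine Finset.sum_congr rfl fun i _ => ?_
              simp
              ring
          _ = α := by rw [h1, h2, ← add_mul, hab, one_mul]
      have hRpos : ∀ z ∈ R, ∀ i, 0 ≤ z i := fun z hz i => by
        rw [hR] at hz
        exact hz.2 i
      -- a point of F with maximal support
      have hpt : ∀ s : Finset ι, ∃ z ∈ F, ∀ i ∈ s, z i = 0 → ∀ y ∈ R, y i = 0 := by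
        intro s
        induction s using Finset.induction_on with
        | empty =>
          obtain ⟨z, hz⟩ := hne
          exact ⟨z, hz, by simp⟩
        | insert j s _ ih =>
          obtain ⟨z, hz, hzs⟩ := ih
          by_cases hj : {z ∈ R | z j = 0} = R
          · refine ⟨z, hz, fun i hi h0 => ?_⟩
            rcases Finset.mem_insert.1 hi with rfl | hi
            · intro y hy
              rw [← hj] at hy
              exact hy.2
            · exact hzs i hi h0
          · have := hcon j hj
            obtain ⟨z', hz', hzj⟩ := Set.not_subset.1 this
            refine ⟨(1/2 : ℝ) • z + (1/2 : ℝ) • z',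
              hFconv hz hz' (by norm_num) (by norm_num) (by norm_num), fun i hi h0 => ?_⟩
            have p1 := hRpos z (hFR hz) i
            have p2 := hRpos z' (hFR hz') i
            simp at h0
            rcases Finset.mem_insert.1 hi with rfl | hi
            · exact absurd ⟨hFR hz', by linarith⟩ hzj
            · exact hzs i hi (by linarith)
      obtain ⟨z, hz, hzs⟩ := hpt Finset.univ
      apply hneq
      refine Set.Subset.antisymm hFR fun y hy => ?_
      obtain ⟨ε, hε, hm⟩ := hstep z (hFR hz) y hy (fun i h0 => hzs i (Finset.mem_univ i) h0 y hy)
      have h1 := hle _ hm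
      have h2 := hle y hy
      rw [hF] at hz ⊢
      refine ⟨hy, le_antisymm h2 ?_⟩
      have h3 : ∑ i, c i * (z + ε • (z - y)) i
          = (∑ i, c i * z i) + ε * ((∑ i, c i * z i) - ∑ i, c i * y i) := by
        rw [← Finset.sum_sub_distrib, Finset.mul_sum, ← Finset.sum_add_distrib]
        refine Finset.sum_congr rfl fun i _ => ?_
        simp
        ring
      rw [h3, hz.2] at h1
      by_contra hlt
      push Not at hlt
      have := mul_pos hε (sub_pos.2 hlt)
      linarith
    calc polySize R ≤ (Set.range (fun i : ι => {z ∈ R | z i = 0})).ncard :=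
          Set.ncard_le_ncard hsub (Set.finite_range _)
      _ ≤ Fintype.card ι := by
          rw [← Set.image_univ]
          refine (Set.ncard_image_le Set.finite_univ).trans ?_
          rw [Set.ncard_univ, Nat.card_eq_fintype_card]

lemma cover {V : Type*} [Fintype V] (G : SimpleGraph V) (hG : IsPerfect G) :
    ∀ n : ℕ, ∀ w : V → ℕ, ∑ v, w v ≤ n → ∀ k : ℕ,
      (∀ C : Finset V, G.IsClique C → ∑ v ∈ C, w v ≤ k) →
      ∃ f : Fin k → Set V, (∀ i, ∀ u ∈ f i, ∀ v ∈ f i, ¬ G.Adj u v) ∧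
        ∀ v, w v ≤ {i | v ∈ f i}.ncard := by
  classical
  intro n
  induction n using Nat.strong_induction_on with
  | _ n ih =>
  intro w hw k hk
  by_cases hle : ∀ v, w v ≤ 1
  · -- use perfection
    let s : Set V := {v | w v = 1}
    have hcl : cliqueNum (G.induce s) ≤ k := by
      refine csSup_le ⟨0, ∅, by simp⟩ ?_
      rintro m ⟨C, hC⟩
      have h1 := hk (C.map (Function.Embedding.subtype _)) (by
        intro a ha b hb hab
        simp only [Finset.coe_map, Set.mem_image, Function.Embedding.subtype_apply] at ha hb
        obtain ⟨a, ha, rfl⟩ := ha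
        obtain ⟨b, hb, rfl⟩ := hb
        exact hC.isClique ha hb (fun h => hab (by rw [h])))
      rw [Finset.sum_map] at h1
      have h2 : ∑ x ∈ C, w ((Function.Embedding.subtype (fun v => v ∈ s)) x) = ∑ x ∈ C, 1 :=
        Finset.sum_congr rfl fun x _ => x.2
      rw [h2] at h1
      simp only [Finset.sum_const, smul_eq_mul, mul_one] at h1
      exact hC.card_eq ▸ h1
    have hcol : (G.induce s).Colorable k := by
      rw [← SimpleGraph.chromaticNumber_le_iff_colorable, hG s]
      exact_mod_cast hcl
    obtain ⟨c⟩ := hcol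
    refine ⟨fun i => {v | ∃ h : v ∈ s, c ⟨v, h⟩ = i}, ?_, ?_⟩
    · rintro i u ⟨hu, rfl⟩ v ⟨hv, hc⟩ hadj
      exact c.valid (v := ⟨u, hu⟩) (w := ⟨v, hv⟩) hadj hc.symm
    · intro v
      by_cases hv : v ∈ s
      · have h1 : w v = 1 := hv
        rw [h1, Nat.one_le_iff_ne_zero]
        apply Set.ncard_ne_zero_of_mem (a := c ⟨v, hv⟩)
        exact ⟨hv, rfl⟩
      · have h0 : w v = 0 := by
          have := hle v
          have h2 : w v ≠ 1 := hv
          omega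
        simp [h0]
  · push Not at hle
    obtain ⟨v, hv⟩ := hle
    let w' : V → ℕ := fun u => if u = v then w u - 1 else w u
    have hw' : ∑ u, w' u < ∑ u, w u := by
      refine Finset.sum_lt_sum (fun u _ => ?_) ⟨v, Finset.mem_univ v, ?_⟩
      · simp only [w']; split_ifs <;> omega
      · simp only [w', if_true]; omega
    have hw'le : ∀ u, w' u ≤ w u := fun u => by simp only [w']; split_ifs <;> omega
    obtain ⟨f, hf, hcov⟩ := ih _ (lt_of_lt_of_le hw' hw) w' le_rfl k
      (fun C hC => (Finset.sum_le_sum fun u _ => hw'le u).trans (hk C hC))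
    have hvpos : 0 < {i | v ∈ f i}.ncard := by
      refine lt_of_lt_of_le ?_ (hcov v)
      simp only [w', if_true]; omega
    obtain ⟨j, hj⟩ := (Set.ncard_pos).1 hvpos
    have hj : v ∈ f j := hj
    let w'' : V → ℕ := fun u => if u ∈ f j ∧ u ≠ v then w' u - 1 else w' u
    have hw''le : ∀ u, w'' u ≤ w' u := fun u => by simp only [w'']; split_ifs <;> omega
    obtain ⟨k, rfl⟩ : ∃ m, k = m + 1 := ⟨k - 1, by have := j.2; omega⟩
    obtain ⟨f', hf', hcov'⟩ := ih (∑ u, w' u) (lt_of_lt_of_le hw' hw) w''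
      (Finset.sum_le_sum fun u _ => hw''le u) k (by
        intro C hC
        by_cases hlt : ∑ u ∈ C, w' u ≤ k
        · exact (Finset.sum_le_sum fun u _ => hw''le u).trans hlt
        have hub := hk C hC
        have hvC : v ∉ C := by
          intro hvC
          have : ∑ u ∈ C, w' u < ∑ u ∈ C, w u := by
            refine Finset.sum_lt_sum (fun u _ => hw'le u) ⟨v, hvC, ?_⟩
            simp only [w', if_true]; omega
          omega
        -- C meets f j in a vertex of positive weight
        have hmeet : ∃ u ∈ C, u ∈ f j ∧ 0 < w' u := by
          by_contra hcon
          push Not at hcon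
          apply hlt
          have h1 : ∑ u ∈ C, w' u ≤ ∑ u ∈ C, ∑ i ∈ Finset.univ.erase j, if u ∈ f i then 1 else 0 := by
            refine Finset.sum_le_sum fun u hu => ?_
            by_cases huj : u ∈ f j
            · exact (hcon u hu huj).trans (Nat.zero_le _)
            · refine (hcov u).trans ?_
              rw [← Finset.card_filter, ← Set.ncard_coe_finset]
              refine Set.ncard_le_ncard ?_ (Set.toFinite _)
              intro i hi
              have hi : u ∈ f i := hi
              simp only [Finset.coe_filter, Finset.mem_erase, Finset.mem_univ, and_true,
                Set.mem_ofPred_eq]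
              exact ⟨fun h => huj (h ▸ hi), hi⟩
          refine h1.trans ?_
          rw [Finset.sum_comm]
          have h2 : ∀ i ∈ Finset.univ.erase j, (∑ u ∈ C, if u ∈ f i then 1 else 0) ≤ 1 := by
            intro i _
            rw [← Finset.card_filter, Finset.card_le_one]
            intro a ha b hb
            rw [Finset.mem_filter] at ha hb
            by_contra hab
            exact hf i a ha.2 b hb.2 (hC ha.1 hb.1 hab)
          refine (Finset.sum_le_sum h2).trans ?_
          simp
        obtain ⟨u, huC, huj, hupos⟩ := hmeet
        have : ∑ u ∈ C, w'' u < ∑ u ∈ C, w' u := by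
          refine Finset.sum_lt_sum (fun u _ => hw''le u) ⟨u, huC, ?_⟩
          have hne : u ≠ v := fun h => hvC (h ▸ huC)
          simp only [w'', huj, hne, ne_eq, not_false_eq_true, and_self, if_true]
          omega
        have h3 : ∑ u ∈ C, w' u ≤ k + 1 := (Finset.sum_le_sum fun u _ => hw'le u).trans hub
        omega)
    refine ⟨Fin.cons (f j) f', ?_, ?_⟩
    · intro i
      refine Fin.cases ?_ (fun i => ?_) i
      · simpa using hf j
      · simpa using hf' i
    · intro u
      have hcard : {i | u ∈ (Fin.cons (f j) f' : Fin (k+1) → Set V) i}.ncard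
          = (if u ∈ f j then 1 else 0) + {i | u ∈ f' i}.ncard := by
        have hset : ∀ (m : ℕ) (g : Fin m → Set V), {i | u ∈ g i}.ncard
            = ∑ i, if u ∈ g i then 1 else 0 := by
          intro m g
          rw [← Finset.card_filter, ← Set.ncard_coe_finset]
          congr 1
          ext i; simp
        rw [hset, hset, Fin.sum_univ_succ]
        simp
      rw [hcard]
      have h1 := hcov' u
      by_cases huj : u ∈ f j
      · by_cases huv : u = v
        · subst huv
          simp [w'', w'] at h1
          simp [huj]; omega
        · simp [w'', w', huj, huv] at h1
          simp [huj]; omega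
      · have huv : u ≠ v := fun h => huj (h ▸ hj)
        simp [w'', w', huj, huv] at h1
        simpa [huj] using h1

lemma indicator_mem_stab {V : Type*} [Fintype V] (G : SimpleGraph V) (S : Set V)
    (h : ∀ u ∈ S, ∀ v ∈ S, ¬ G.Adj u v) : S.indicator (1 : V → ℝ) ∈ stab G :=
  subset_convexHull ℝ _ ⟨S, h, rfl⟩

lemma stab_gen_finite {V : Type*} [Fintype V] (G : SimpleGraph V) :
    {x : V → ℝ | ∃ S : Set V, (∀ u ∈ S, ∀ v ∈ S, ¬ G.Adj u v) ∧ x = S.indicator 1}.Finite := by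
  refine (Set.finite_range (fun S : Set V => S.indicator (1 : V → ℝ))).subset ?_
  rintro x ⟨S, _, rfl⟩
  exact ⟨S, rfl⟩

lemma antiblocker {V : Type*} [Fintype V] (G : SimpleGraph V) (hG : IsPerfect G) :
    stab Gᶜ = {x | 0 ≤ x ∧ ∀ y ∈ stab G, ∑ v, x v * y v ≤ 1} := by
  classical
  apply Set.Subset.antisymm
  · refine convexHull_min ?_ ?_
    · rintro x ⟨C, hC, rfl⟩
      refine ⟨fun v => Set.indicator_nonneg (fun _ _ => zero_le_one) v, ?_⟩
      have : stab G ⊆ {y | ∑ v, C.indicator (1 : V → ℝ) v * y v ≤ 1} := by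
        refine convexHull_min ?_ ?_
        · rintro y ⟨S, hS, rfl⟩
          have h1 : ∑ v, C.indicator (1 : V → ℝ) v * S.indicator 1 v
              = ((Finset.univ.filter fun v => v ∈ C ∧ v ∈ S).card : ℝ) := by
            rw [Finset.card_filter]
            push_cast
            refine Finset.sum_congr rfl fun v _ => ?_
            by_cases h1 : v ∈ C <;> by_cases h2 : v ∈ S <;> simp [h1, h2]
          simp only [Set.mem_ofPred_eq]
          rw [h1]
          have : (Finset.univ.filter fun v => v ∈ C ∧ v ∈ S).card ≤ 1 := by
            rw [Finset.card_le_one]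
            intro a ha b hb
            simp only [Finset.mem_filter, Finset.mem_univ, true_and] at ha hb
            by_contra hab
            have h3 := hC a ha.1 b hb.1
            rw [SimpleGraph.compl_adj] at h3
            exact h3 ⟨hab, hS a ha.2 b hb.2⟩
          exact_mod_cast this
        · intro y hy z hz a b ha hb hab
          simp only [Set.mem_ofPred_eq] at *
          have : ∑ v, C.indicator (1 : V → ℝ) v * (a • y + b • z) v
              = a * ∑ v, C.indicator (1 : V → ℝ) v * y v
                + b * ∑ v, C.indicator (1 : V → ℝ) v * z v := by
            rw [Finset.mul_sum, Finset.mul_sum, ← Finset.sum_add_distrib]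
            refine Finset.sum_congr rfl fun i _ => ?_
            simp only [Pi.add_apply, Pi.smul_apply, smul_eq_mul]
            ring
          rw [this]
          nlinarith
      exact this
    · rintro y ⟨hy0, hy⟩ z ⟨hz0, hz⟩ a b ha hb hab
      refine ⟨by positivity, fun x hx => ?_⟩
      have h1 := hy x hx
      have h2 := hz x hx
      have : ∑ v, (a • y + b • z) v * x v = a * ∑ v, y v * x v + b * ∑ v, z v * x v := by
        rw [Finset.mul_sum, Finset.mul_sum, ← Finset.sum_add_distrib]
        refine Finset.sum_congr rfl fun i _ => ?_
        simp only [Pi.add_apply, Pi.smul_apply, smul_eq_mul]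
        ring
      rw [this]
      nlinarith
  · rintro x ⟨hx0, hx⟩
    by_contra hxn
    have hclosed : IsClosed (stab Gᶜ) :=
      ((stab_gen_finite Gᶜ).isCompact_convexHull (𝕜 := ℝ)).isClosed
    obtain ⟨f, u, hfu, hux⟩ := geometric_hahn_banach_closed_point
      (convex_convexHull ℝ _) hclosed hxn
    let a : V → ℝ := fun v => f (Pi.single v 1)
    have hfa : ∀ y : V → ℝ, f y = ∑ v, y v * a v := by
      intro y
      have := LinearMap.pi_apply_eq_sum_univ (f : (V → ℝ) →ₗ[ℝ] ℝ) y
      simp only [ContinuousLinearMap.coe_coe, smul_eq_mul] at this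
      rw [this]
      refine Finset.sum_congr rfl fun v _ => ?_
      simp only [a]
      congr 2
      ext j
      simp [Pi.single_apply, eq_comm]
    let b : V → ℝ := fun v => max (a v) 0
    have hb0 : ∀ v, 0 ≤ b v := fun v => le_max_right _ _
    -- clique weights
    have hclq : ∀ C : Finset V, G.IsClique C → ∑ v ∈ C, b v < u := by
      intro C hC
      have h1 := hfu _ (indicator_mem_stab Gᶜ {v | v ∈ C ∧ 0 ≤ a v} (by
        rintro p ⟨hp, _⟩ q ⟨hq, _⟩ hadj
        rw [SimpleGraph.compl_adj] at hadj
        exact hadj.2 (hC hp hq hadj.1)))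
      rw [hfa] at h1
      refine lt_of_eq_of_lt ?_ h1
      rw [← Finset.sum_subset (Finset.subset_univ C)]
      · refine Finset.sum_congr rfl fun v hv => ?_
        by_cases h : 0 ≤ a v
        · simp [b, Set.indicator, hv, h]
        · simp [b, Set.indicator, hv, h]; linarith
      · intro v _ hv
        simp [Set.indicator, hv]
    have hu0 : 0 < u := by simpa using hclq ∅ (by simp)
    have hbx : u < ∑ v, b v * x v := by
      rw [hfa] at hux
      refine hux.trans_le (Finset.sum_le_sum fun v _ => ?_)
      rw [mul_comm]
      exact mul_le_mul_of_nonneg_right (le_max_left _ _) (hx0 v)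
    obtain ⟨N, hN⟩ := exists_nat_gt ((Fintype.card V : ℝ) / ((∑ v, b v * x v) - u))
    rw [div_lt_iff₀ (sub_pos.2 hbx)] at hN
    let w : V → ℕ := fun v => ⌈(N : ℝ) * b v⌉₊
    have hNu : 0 ≤ (N : ℝ) * u + Fintype.card V := by positivity
    obtain ⟨k, hk⟩ : ∃ k, k = ⌊(N : ℝ) * u + Fintype.card V⌋₊ := ⟨_, rfl⟩
    obtain ⟨g, hg, hcov⟩ := cover G hG _ w le_rfl k (by
      intro C hC
      rw [hk]
      apply Nat.le_floor
      push_cast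
      calc ∑ v ∈ C, (w v : ℝ) ≤ ∑ v ∈ C, ((N : ℝ) * b v + 1) :=
            Finset.sum_le_sum fun v _ => (Nat.ceil_lt_add_one (by have := hb0 v; positivity)).le
        _ = N * ∑ v ∈ C, b v + C.card := by
            rw [Finset.sum_add_distrib, Finset.mul_sum]; simp
        _ ≤ N * u + Fintype.card V := by
            have h1 : (C.card : ℝ) ≤ Fintype.card V := by exact_mod_cast Finset.card_le_univ C
            have h2 := mul_le_mul_of_nonneg_left (hclq C hC).le (Nat.cast_nonneg (α := ℝ) N)
            linarith)
    have hkle : (k : ℝ) ≤ N * u + Fintype.card V := hk ▸ Nat.floor_le hNu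
    have h1 : (N : ℝ) * ∑ v, b v * x v ≤ ∑ v, (w v : ℝ) * x v := by
      rw [Finset.mul_sum]
      refine Finset.sum_le_sum fun v _ => ?_
      rw [← mul_assoc]
      exact mul_le_mul_of_nonneg_right (Nat.le_ceil _) (hx0 v)
    have h2 : ∑ v, (w v : ℝ) * x v ≤ ∑ v, ∑ i, x v * (g i).indicator 1 v := by
      refine Finset.sum_le_sum fun v _ => ?_
      rw [← Finset.mul_sum, mul_comm]
      refine mul_le_mul_of_nonneg_left ?_ (hx0 v)
      have h3 : ({i | v ∈ g i}.ncard : ℝ) = ∑ i, (g i).indicator (1 : V → ℝ) v := by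
        have : {i | v ∈ g i} = ((Finset.univ.filter fun i => v ∈ g i : Finset (Fin k)) : Set (Fin k)) := by
          ext i; simp
        rw [this, Set.ncard_coe_finset, Finset.card_filter]
        push_cast
        refine Finset.sum_congr rfl fun i _ => ?_
        simp [Set.indicator]
      rw [← h3]
      exact_mod_cast hcov v
    rw [Finset.sum_comm] at h2
    have h4 : ∑ i, ∑ v, x v * (g i).indicator 1 v ≤ ∑ i : Fin k, (1 : ℝ) :=
      Finset.sum_le_sum fun i _ => hx _ (indicator_mem_stab G (g i) (hg i))
    simp at h4
    nlinarith
/-- for a perfect graph `G = (V, E)` with complement `Ḡ`,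
`xc (STAB Ḡ) ≤ xc (STAB G) + |V|`. -/
theorem xc_stab_compl_le {V : Type*} [Fintype V] (G : SimpleGraph V)
    (hG : IsPerfect G) :
    xc (stab Gᶜ) ≤ xc (stab G) + Fintype.card V := by
  classical
  rcases isEmpty_or_nonempty V with hV | hV
  · -- trivial case
    have hB := polytope_of_orthant (ι := Fin 0) Set.univ Set.univ (by simp) isClosed_univ
      (by ext z; simp) (Set.toFinite _).isBounded
    have hmem : polySize (Set.univ : Set (Fin 0 → ℝ)) ∈ {r : ℕ | ∃ (k : ℕ) (Q : Set (Fin k → ℝ)),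
        IsExtension (stab Gᶜ) Q ∧ polySize Q = r} := by
      refine ⟨0, Set.univ, ⟨hB.1, 0, ?_⟩, rfl⟩
      have hne : (stab Gᶜ).Nonempty := ⟨_, indicator_mem_stab Gᶜ ∅ (by simp)⟩
      ext y
      have hy : ∀ z : V → ℝ, z = y := fun z => Subsingleton.elim _ _
      refine ⟨fun _ => ?_, fun _ => ⟨0, Set.mem_univ _, hy _⟩⟩
      obtain ⟨z, hz⟩ := hne
      exact hy z ▸ hz
    have h1 := Nat.sInf_le hmem
    have h2 := hB.2
    simp only [Fintype.card_fin] at h2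
    unfold xc
    omega
  -- an optimal extension of `stab G`
  have hnonempty : {r : ℕ | ∃ (k : ℕ) (Q : Set (Fin k → ℝ)),
      IsExtension (stab G) Q ∧ polySize Q = r}.Nonempty := by
    let e := Fintype.equivFin V
    let L := LinearEquiv.funCongrLeft ℝ ℝ e.symm
    refine ⟨_, Fintype.card V, L '' stab G, ⟨⟨_, (stab_gen_finite G).image L, ?_⟩,
      (L.symm : _ →ₗ[ℝ] _), ?_⟩, rfl⟩
    · exact L.toLinearMap.image_convexHull _
    · rw [Set.image_image]
      simp
  obtain ⟨m, Q, ⟨⟨T, hT, rfl⟩, π, hπ⟩, hsize⟩ := Nat.sInf_mem hnonempty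
  have hfacfin : {F | IsFacet (convexHull ℝ T) F}.Finite :=
    (facets_finite T hT).subset fun _ h => h.1
  let I := {F | IsFacet (convexHull ℝ T) F}
  have : Fintype I := hfacfin.fintype
  have hcardI : Fintype.card I = xc (stab G) := by
    unfold xc
    rw [← hsize, polySize, ← Nat.card_eq_fintype_card]
    rfl
  have hSex : ∀ F : I, ∃ p, (∀ y ∈ convexHull ℝ T, 0 ≤ slk p y) ∧
      (F : Set (Fin m → ℝ)) = {y ∈ convexHull ℝ T | slk p y = 0} :=
    fun F => (exposed_slk _ _).1 F.2.1
  choose S hS hSF using hSex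
  have hnt : (convexHull ℝ T).Nontrivial := by
    obtain ⟨v⟩ := hV
    have h0 : (∅ : Set V).indicator (1 : V → ℝ) ∈ stab G := indicator_mem_stab G ∅ (by simp)
    have h1 : ({v} : Set V).indicator (1 : V → ℝ) ∈ stab G := indicator_mem_stab G {v} (by simp)
    rw [← hπ] at h0 h1
    obtain ⟨a, ha, ha'⟩ := h0
    obtain ⟨b, hb, hb'⟩ := h1
    refine ⟨a, ha, b, hb, fun hab => ?_⟩
    rw [hab, hb'] at ha'
    have := congrFun ha' v
    simp at this
  have hdec := decompose T hT hnt S hS (fun F hF => ⟨⟨F, hF⟩, hSF ⟨F, hF⟩⟩)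
  let e := Fintype.equivFin (V ⊕ I)
  let k := Fintype.card (V ⊕ I)
  let A : Set (Fin k → ℝ) := {z | ∀ y ∈ convexHull ℝ T,
    1 - ∑ v, z (e (Sum.inl v)) * π y v = ∑ i, z (e (Sum.inr i)) * slk (S i) y}
  let R : Set (Fin k → ℝ) := {z | z ∈ A ∧ 0 ≤ z}
  have hπmem : ∀ y ∈ convexHull ℝ T, π y ∈ stab G := fun y hy => hπ ▸ Set.mem_image_of_mem _ hy
  have hproj : ∀ z ∈ R, (fun v => z (e (Sum.inl v))) ∈ stab Gᶜ := by
    rintro z ⟨hzA, hz0⟩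
    rw [antiblocker G hG]
    refine ⟨fun v => hz0 _, fun y hy => ?_⟩
    rw [← hπ] at hy
    obtain ⟨q, hq, rfl⟩ := hy
    have h1 := hzA q hq
    have h2 : 0 ≤ ∑ i, z (e (Sum.inr i)) * slk (S i) q :=
      Finset.sum_nonneg fun i _ => mul_nonneg (hz0 _) (hS i q hq)
    simp only
    linarith
  have hπnn : ∀ y ∈ convexHull ℝ T, ∀ v, 0 ≤ π y v := by
    intro y hy v
    have : stab G ⊆ {x | 0 ≤ x} := by
      refine convexHull_min ?_ (convex_Ici (0 : V → ℝ))
      rintro x ⟨C, _, rfl⟩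
      exact fun v => Set.indicator_nonneg (fun _ _ => zero_le_one) v
    exact this (hπmem y hy) v
  have hbd : ∀ j : Fin k, ∃ M : ℝ, ∀ z ∈ R, z j ≤ M := by
    intro j
    obtain ⟨s, rfl⟩ := e.surjective j
    rcases s with v | i
    · refine ⟨1, fun z hz => ?_⟩
      have h1 := hproj z hz
      rw [antiblocker G hG] at h1
      have h2 := h1.2 _ (indicator_mem_stab G {v} (by simp))
      simpa [Set.indicator, Finset.sum_ite_eq] using h2
    · have hne : ∃ y ∈ convexHull ℝ T, slk (S i) y ≠ 0 := by
        by_contra hcon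
        push Not at hcon
        apply i.2.2.2.1
        rw [hSF i]
        ext y
        exact ⟨fun h => h.1, fun h => ⟨h, hcon y h⟩⟩
      obtain ⟨y, hy, hy0⟩ := hne
      have hpos : 0 < slk (S i) y := lt_of_le_of_ne (hS i y hy) (Ne.symm hy0)
      refine ⟨1 / slk (S i) y, fun z hz => ?_⟩
      rw [le_div_iff₀ hpos]
      have h1 := hz.1 y hy
      have h2 : 0 ≤ ∑ v, z (e (Sum.inl v)) * π y v :=
        Finset.sum_nonneg fun v _ => mul_nonneg (hz.2 _) (hπnn y hy v)
      have h3 := Finset.single_le_sum (f := fun i => z (e (Sum.inr i)) * slk (S i) y)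
        (fun i _ => mul_nonneg (hz.2 _) (hS i y hy)) (Finset.mem_univ i)
      linarith
  choose M hM using hbd
  have hbounded : Bornology.IsBounded R :=
    (Metric.isBounded_Icc (0 : Fin k → ℝ) M).subset fun z hz => ⟨hz.2, fun j => hM j z hz⟩
  have hB := polytope_of_orthant A R (by
      intro z hz z' hz' t y hy
      have h1 := hz y hy
      have h2 := hz' y hy
      simp only [Pi.add_apply, Pi.smul_apply, Pi.sub_apply, smul_eq_mul, add_mul, sub_mul, mul_sub,
        Finset.sum_add_distrib, Finset.sum_sub_distrib, mul_assoc, ← Finset.mul_sum]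
      linear_combination (1 + t) * h1 - t * h2)
    (by
      have : A = ⋂ y ∈ convexHull ℝ T, {z : Fin k → ℝ |
          1 - ∑ v, z (e (Sum.inl v)) * π y v = ∑ i, z (e (Sum.inr i)) * slk (S i) y} := by
        ext z; simp [A]
      rw [this]
      refine isClosed_biInter fun y _ => isClosed_eq ?_ ?_ <;> fun_prop) rfl hbounded
  have hmem : polySize R ∈ {r : ℕ | ∃ (k : ℕ) (Q : Set (Fin k → ℝ)),
      IsExtension (stab Gᶜ) Q ∧ polySize Q = r} := by
    refine ⟨k, R, ⟨hB.1, LinearMap.funLeft ℝ ℝ (fun v => e (Sum.inl v)), ?_⟩, rfl⟩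
    apply Set.Subset.antisymm
    · rintro _ ⟨z, hz, rfl⟩
      exact hproj z hz
    · intro x hx
      rw [antiblocker G hG] at hx
      have hslk : ∀ y, slk ((fun i => ∑ v, x v * π (Pi.single i 1) v), 1) y
          = 1 - ∑ v, x v * π y v := by
        intro y
        simp only [slk]
        congr 1
        have h1 : ∀ v, π y v = ∑ i, y i * π (Pi.single i 1) v := by
          intro v
          have h2 := LinearMap.pi_apply_eq_sum_univ π y
          rw [h2]
          simp only [Finset.sum_apply, Pi.smul_apply, smul_eq_mul]
          refine Finset.sum_congr rfl fun i _ => ?_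
          have h3 : (fun j => if i = j then (1 : ℝ) else 0) = Pi.single i 1 := by
            ext j
            simp [Pi.single_apply, eq_comm]
          rw [h3]
        simp only [h1, Finset.sum_mul, Finset.mul_sum]
        rw [Finset.sum_comm]
        refine Finset.sum_congr rfl fun v _ => Finset.sum_congr rfl fun i _ => ?_
        ring
      obtain ⟨l, hl0, hl⟩ := hdec ((fun i => ∑ v, x v * π (Pi.single i 1) v), 1) (by
        intro y hy
        rw [hslk]
        have := hx.2 _ (hπmem y hy)
        linarith)
      refine ⟨fun j => Sum.elim x l (e.symm j), ⟨?_, ?_⟩, ?_⟩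
      · intro y hy
        have := hl y hy
        rw [hslk] at this
        simpa using this
      · intro j
        simp only [Pi.zero_apply]
        rcases e.symm j with v | i
        · exact hx.1 v
        · exact hl0 i
      · ext v
        simp [LinearMap.funLeft_apply]
  calc xc (stab Gᶜ) ≤ polySize R := Nat.sInf_le hmem
    _ ≤ Fintype.card (Fin k) := hB.2
    _ = xc (stab G) + Fintype.card V := by
        rw [Fintype.card_fin, ← hcardI, add_comm]
        exact Fintype.card_sum
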